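/- arXiv:1611.02743 — 2 statements merged into one kernel-verified Lean document; each statement's English description precedes it below -/
import Mathlib

section
/- Let A₁, A₂ ∈ SL(2,ℂ) with tr A₁, tr A₂ and tr(A₁A₂) all real. If the pair (A₁,A₂) is elementwise-periodic, then the full orbit set {χ(α) : α an automorphism of F₂} is finite. (In the paper's notation, 𝒫₂ = 𝓕₂.) -/
open Matrix

noncomputable section

abbrev SL2C := Matrix.SpecialLinearGroup (Fin 2) ℂ

/-- The representation `F₂ → SL(2,ℂ)` sending `a₁ ↦ A₁`, `a₂ ↦ A₂`. -/
def rho (A₁ A₂ : SL2C) : FreeGroup (Fin 2) →* SL2C := FreeGroup.lift ![A₁, A₂]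

/-- `χ(α) = (tr ρ(α a₁)/2, tr ρ(α a₂)/2, tr ρ(α (a₁a₂))/2)`. -/
def chi (A₁ A₂ : SL2C) (α : MulAut (FreeGroup (Fin 2))) : ℂ × ℂ × ℂ :=
  ( Matrix.trace ((rho A₁ A₂ (α (FreeGroup.of 0)) : Matrix (Fin 2) (Fin 2) ℂ)) / 2,
    Matrix.trace ((rho A₁ A₂ (α (FreeGroup.of 1)) : Matrix (Fin 2) (Fin 2) ℂ)) / 2,
    Matrix.trace ((rho A₁ A₂ (α (FreeGroup.of 0 * FreeGroup.of 1)) : Matrix (Fin 2) (Fin 2) ℂ)) / 2 )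

/-- `(A₁,A₂)` is elementwise-periodic. -/
def ElemPeriodic (A₁ A₂ : SL2C) : Prop :=
  ∀ α : MulAut (FreeGroup (Fin 2)), (Set.range fun k : ℕ => chi A₁ A₂ (α ^ k)).Finite


lemma rho_of0 (A B : SL2C) : rho A B (FreeGroup.of 0) = A := by simp [rho]
lemma rho_of1 (A B : SL2C) : rho A B (FreeGroup.of 1) = B := by simp [rho]

lemma rho_comp (A B : SL2C) (γ : MulAut (FreeGroup (Fin 2))) (w : FreeGroup (Fin 2)) :
    rho A B (γ w) = rho (rho A B (γ (FreeGroup.of 0))) (rho A B (γ (FreeGroup.of 1))) w := by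
  have : (rho A B).comp γ.toMonoidHom =
      rho (rho A B (γ (FreeGroup.of 0))) (rho A B (γ (FreeGroup.of 1))) := by
    ext i : 1
    fin_cases i
    · simp [rho_of0]
    · simp [rho_of1]
  exact DFunLike.congr_fun this w

/-- trace of an element of `SL(2,ℂ)` -/
def tc (A : SL2C) : ℂ := Matrix.trace (A : Matrix (Fin 2) (Fin 2) ℂ)

lemma tc_eq (A : SL2C) : tc A = A.1 0 0 + A.1 1 1 := by
  simp [tc, Matrix.trace_fin_two]

lemma det_eq (A : SL2C) : A.1 0 0 * A.1 1 1 - A.1 0 1 * A.1 1 0 = 1 := by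
  have := A.2
  rwa [Matrix.det_fin_two] at this

lemma tc_mul_comm (A B : SL2C) : tc (A * B) = tc (B * A) := by
  simp only [tc, Matrix.SpecialLinearGroup.coe_mul]
  exact Matrix.trace_mul_comm _ _

/-- the tuple of traces -/
def tv (A B : SL2C) : Fin 3 → ℂ := ![tc A, tc B, tc (A * B)]

/-- linear combination of `1, A, B, AB` -/
def lc (A B : SL2C) (p q r s : ℂ) : Matrix (Fin 2) (Fin 2) ℂ :=
  p • (1 : Matrix (Fin 2) (Fin 2) ℂ) + q • A.1 + r • B.1 + s • (A.1 * B.1)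

lemma lc_A (A B : SL2C) (p q r s : ℂ) :
    A.1 * lc A B p q r s = lc A B (-q) (p + q * tc A) (-s) (r + s * tc A) := by
  have hA := det_eq A
  ext i j
  fin_cases i <;> fin_cases j <;>
    simp [lc, Matrix.mul_apply, Fin.sum_univ_two, tc_eq, Matrix.add_apply] <;>
    grind

lemma lc_B (A B : SL2C) (p q r s : ℂ) :
    B.1 * lc A B p q r s = lc A B
      (q * (tc (A * B) - tc A * tc B) - r - s * tc A)
      (q * tc B + s)
      (p + q * tc A + r * tc B + s * (tc (A * B)))
      (-q) := by
  have hA := det_eq A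
  have hB := det_eq B
  ext i j
  fin_cases i <;> fin_cases j <;>
    simp [lc, Matrix.mul_apply, Fin.sum_univ_two, tc_eq, Matrix.add_apply] <;>
    grind

lemma lc_lin (A B : SL2C) (t p q r s p' q' r' s' : ℂ) :
    t • lc A B p q r s - lc A B p' q' r' s' =
      lc A B (t * p - p') (t * q - q') (t * r - r') (t * s - s') := by
  ext i j
  simp [lc]
  ring

lemma inv_eq' (A : SL2C) : (A⁻¹ : SL2C).1 = tc A • (1 : Matrix (Fin 2) (Fin 2) ℂ) - A.1 := by
  ext i j
  rw [Matrix.SpecialLinearGroup.SL2_inv_expl]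
  fin_cases i <;> fin_cases j <;> simp [tc_eq]

lemma inv_mul_ch (A : SL2C) (M : Matrix (Fin 2) (Fin 2) ℂ) :
    (A⁻¹ : SL2C).1 * M = tc A • M - A.1 * M := by
  rw [inv_eq', Matrix.sub_mul, Matrix.smul_mul, Matrix.one_mul]

open MvPolynomial in
lemma fricke_lc (w : FreeGroup (Fin 2)) : ∃ p q r s : MvPolynomial (Fin 3) ℤ, ∀ A B : SL2C,
    (rho A B w).1 = lc A B (aeval (tv A B) p) (aeval (tv A B) q) (aeval (tv A B) r)
      (aeval (tv A B) s) := by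
  have stepA : ∀ u : FreeGroup (Fin 2), (∃ p q r s : MvPolynomial (Fin 3) ℤ, ∀ A B : SL2C,
      (rho A B u).1 = lc A B (aeval (tv A B) p) (aeval (tv A B) q) (aeval (tv A B) r)
      (aeval (tv A B) s)) → ∀ i : Fin 2, (∃ p q r s : MvPolynomial (Fin 3) ℤ, ∀ A B : SL2C,
      (rho A B (FreeGroup.of i * u)).1 = lc A B (aeval (tv A B) p) (aeval (tv A B) q)
      (aeval (tv A B) r) (aeval (tv A B) s)) := by
    rintro u ⟨p, q, r, s, h⟩ i
    fin_cases i
    · refine ⟨-q, p + q * X 0, -s, r + s * X 0, fun A B => ?_⟩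
      have : (rho A B (FreeGroup.of 0 * u)).1 = A.1 * (rho A B u).1 := by
        rw [map_mul, rho_of0]; rfl
      refine this.trans ?_
      rw [h, lc_A]
      simp [tv]
    · refine ⟨q * (X 2 - X 0 * X 1) - r - s * X 0, q * X 1 + s, p + q * X 0 + r * X 1 + s * X 2,
        -q, fun A B => ?_⟩
      have : (rho A B (FreeGroup.of 1 * u)).1 = B.1 * (rho A B u).1 := by
        rw [map_mul, rho_of1]; rfl
      refine this.trans ?_
      rw [h, lc_B]
      simp [tv]
  have stepI : ∀ u : FreeGroup (Fin 2), (∃ p q r s : MvPolynomial (Fin 3) ℤ, ∀ A B : SL2C,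
      (rho A B u).1 = lc A B (aeval (tv A B) p) (aeval (tv A B) q) (aeval (tv A B) r)
      (aeval (tv A B) s)) → ∀ i : Fin 2, (∃ p q r s : MvPolynomial (Fin 3) ℤ, ∀ A B : SL2C,
      (rho A B ((FreeGroup.of i)⁻¹ * u)).1 = lc A B (aeval (tv A B) p) (aeval (tv A B) q)
      (aeval (tv A B) r) (aeval (tv A B) s)) := by
    rintro u hu i
    obtain ⟨p', q', r', s', h'⟩ := stepA u hu i
    obtain ⟨p, q, r, s, h⟩ := hu
    obtain ⟨T, hT⟩ : ∃ T : MvPolynomial (Fin 3) ℤ, ∀ A B : SL2C,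
        tc (rho A B (FreeGroup.of i)) = aeval (tv A B) T := by
      fin_cases i
      · exact ⟨X 0, fun A B => by simp [tv, rho_of0]⟩
      · exact ⟨X 1, fun A B => by simp [tv, rho_of1]⟩
    refine ⟨T * p - p', T * q - q', T * r - r', T * s - s', fun A B => ?_⟩
    have e1 : (rho A B ((FreeGroup.of i)⁻¹ * u)).1 =
        ((rho A B (FreeGroup.of i))⁻¹ : SL2C).1 * (rho A B u).1 := by
      rw [map_mul, map_inv]; rfl
    have e2 : (rho A B (FreeGroup.of i * u)).1 =
        (rho A B (FreeGroup.of i)).1 * (rho A B u).1 := by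
      rw [map_mul]; rfl
    rw [e1, inv_mul_ch, ← e2, h, h', hT, lc_lin]
    simp
  have gen : ∀ v u : FreeGroup (Fin 2), (∃ p q r s : MvPolynomial (Fin 3) ℤ, ∀ A B : SL2C,
      (rho A B u).1 = lc A B (aeval (tv A B) p) (aeval (tv A B) q) (aeval (tv A B) r)
      (aeval (tv A B) s)) → (∃ p q r s : MvPolynomial (Fin 3) ℤ, ∀ A B : SL2C,
      (rho A B (v * u)).1 = lc A B (aeval (tv A B) p) (aeval (tv A B) q)
      (aeval (tv A B) r) (aeval (tv A B) s)) := by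
    intro v
    induction v using FreeGroup.induction_on with
    | C1 => intro u hu; simpa using hu
    | of i => exact fun u hu => stepA u hu i
    | inv_of i _ => exact fun u hu => stepI u hu i
    | mul x y hx hy => intro u hu; rw [mul_assoc]; exact hx _ (hy _ hu)
  have := gen w 1 ⟨1, 0, 0, 0, fun A B => by simp [lc]⟩
  simpa using this

open MvPolynomial in
lemma fricke (w : FreeGroup (Fin 2)) : ∃ T : MvPolynomial (Fin 3) ℤ, ∀ A B : SL2C,
    tc (rho A B w) = aeval (tv A B) T := by
  obtain ⟨p, q, r, s, h⟩ := fricke_lc w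
  refine ⟨2 * p + q * X 0 + r * X 1 + s * X 2, fun A B => ?_⟩
  rw [tc, h]
  simp [lc, tv, tc, Matrix.trace_add, Matrix.trace_smul]
  ring

lemma chi_eq (A B : SL2C) (α : MulAut (FreeGroup (Fin 2))) : chi A B α =
    (tc (rho A B (α (FreeGroup.of 0))) / 2, tc (rho A B (α (FreeGroup.of 1))) / 2,
      tc (rho A B (α (FreeGroup.of 0 * FreeGroup.of 1))) / 2) := rfl

/-- The trace of `ρ(γ w)` is a function of `χ(γ)`. -/
lemma fricke_chi (w : FreeGroup (Fin 2)) : ∃ F : ℂ × ℂ × ℂ → ℂ, ∀ (A B : SL2C)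
    (γ : MulAut (FreeGroup (Fin 2))), tc (rho A B (γ w)) = F (chi A B γ) := by
  obtain ⟨T, hT⟩ := fricke w
  refine ⟨fun c => MvPolynomial.aeval ![2 * c.1, 2 * c.2.1, 2 * c.2.2] T, fun A B γ => ?_⟩
  rw [rho_comp, hT, chi_eq]
  congr 2
  simp only [tv, map_mul]
  ext i
  fin_cases i <;> simp <;> ring

/-- The twist. -/
def tw : MulAut (FreeGroup (Fin 2)) :=
  MonoidHom.toMulEquiv
    (FreeGroup.lift ![FreeGroup.of 0, FreeGroup.of 0 * FreeGroup.of 1])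
    (FreeGroup.lift ![FreeGroup.of 0, (FreeGroup.of 0)⁻¹ * FreeGroup.of 1])
    (by ext i; fin_cases i <;> simp)
    (by ext i; fin_cases i <;> simp)

lemma tw0 : tw (FreeGroup.of 0) = FreeGroup.of 0 := by simp [tw]
lemma tw1 : tw (FreeGroup.of 1) = FreeGroup.of 0 * FreeGroup.of 1 := by simp [tw]

lemma tw_pow0 (k : ℕ) : (tw ^ k) (FreeGroup.of 0) = FreeGroup.of 0 := by
  induction k with
  | zero => rfl
  | succ k ih => rw [pow_succ, MulAut.mul_apply, tw0, ih]

lemma tw_pow1 (k : ℕ) : (tw ^ k) (FreeGroup.of 1) = (FreeGroup.of 0) ^ k * FreeGroup.of 1 := by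
  induction k with
  | zero => simp
  | succ k ih => rw [pow_succ, MulAut.mul_apply, tw1, map_mul, ih, tw_pow0, pow_succ', mul_assoc]

/-- The swap. -/
def sw : MulAut (FreeGroup (Fin 2)) := FreeGroup.freeGroupCongr (Equiv.swap 0 1)

lemma sw0 : sw (FreeGroup.of 0) = FreeGroup.of 1 := by simp [sw]
lemma sw1 : sw (FreeGroup.of 1) = FreeGroup.of 0 := by simp [sw]

lemma tc_rec (A B : SL2C) : tc (A * (A * B)) = tc A * tc (A * B) - tc B := by
  have hA := det_eq A
  simp [tc_eq, Matrix.mul_apply, Fin.sum_univ_two]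
  grind

lemma exists_pair (t : ℂ) : ∃ l m : ℂ, l * m = 1 ∧ l + m = t := by
  obtain ⟨s, hs⟩ := IsAlgClosed.exists_pow_nat_eq (t ^ 2 - 4) (n := 2) (by norm_num)
  refine ⟨(t + s) / 2, (t - s) / 2, ?_, by ring⟩
  linear_combination (-1 / 4 : ℂ) * hs

/-- `t` is twice the cosine of a rational angle -/
def RT (t : ℂ) : Prop := ∃ l m : ℂ, l * m = 1 ∧ l + m = t ∧ ∃ n : ℕ, 0 < n ∧ l ^ n = 1

lemma root_of_finite (t : ℂ) (y : ℕ → ℂ) (hy : ∀ k, y (k + 2) = t * y (k + 1) - y k)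
    (hf : (Set.range fun k => (y k, y (k + 1))).Finite) : RT t ∨ (y 0 = 0 ∧ y 1 = 0) := by
  obtain ⟨l, m, hlm, hs⟩ := exists_pair t
  by_cases hR : RT t
  · exact Or.inl hR
  right
  have hnr : ∀ n : ℕ, 0 < n → l ^ n ≠ 1 := fun n hn h => hR ⟨l, m, hlm, hs, n, hn, h⟩
  have hnr' : ∀ n : ℕ, 0 < n → m ^ n ≠ 1 := fun n hn h =>
    hnr n hn (by have := congrArg (· ^ n) hlm; simpa [mul_pow, h] using this)
  have hl0 : l ≠ 0 := left_ne_zero_of_mul_eq_one hlm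
  have hm0 : m ≠ 0 := right_ne_zero_of_mul_eq_one hlm
  have gen : ∀ l m : ℂ, l * m = 1 → l + m = t → ∀ k, y (k + 1) - m * y k = l ^ k * (y 1 - m * y 0) := by
    intro l m hlm hs k
    induction k with
    | zero => simp
    | succ k ih =>
      rw [hy, pow_succ]
      linear_combination l * ih - y (k+1) * hs + y k * hlm
  obtain ⟨i, j, hij, h⟩ : ∃ i j, i < j ∧ (y i, y (i + 1)) = (y j, y (j + 1)) := by
    by_contra! hcon
    have hinj : Function.Injective fun k => (y k, y (k + 1)) := by
      intro a b hab
      rcases lt_trichotomy a b with h | h | h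
      · exact absurd hab (hcon a b h)
      · exact h
      · exact absurd hab.symm (hcon b a h)
    exact Set.infinite_range_of_injective hinj hf
  have h1 : y i = y j := congrArg Prod.fst h
  have h2 : y (i + 1) = y (j + 1) := congrArg Prod.snd h
  have fin : ∀ l m : ℂ, l * m = 1 → l + m = t → l ≠ 0 → (∀ n : ℕ, 0 < n → l ^ n ≠ 1) →
      y 1 - m * y 0 = 0 := by
    intro l m hlm hs hl0 hn
    have e : l ^ i * (y 1 - m * y 0) = l ^ j * (y 1 - m * y 0) := by
      rw [← gen l m hlm hs, ← gen l m hlm hs, h1, h2]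
    by_contra hc
    have e' := mul_right_cancel₀ hc e
    have : l ^ j = l ^ i * l ^ (j - i) := by rw [← pow_add]; congr 1; omega
    rw [this] at e'
    exact hn (j - i) (by omega) (mul_left_cancel₀ (pow_ne_zero i hl0) (by rw [← e', mul_one]))
  have c := fin l m hlm hs hl0 hnr
  have d := fin m l (by rw [mul_comm, hlm]) (by rw [add_comm, hs]) hm0 hnr'
  have hne : l - m ≠ 0 := by
    intro h0
    apply hnr 2 (by norm_num)
    linear_combination l * h0 + hlm
  have y0 : y 0 = 0 := by
    have : (l - m) * y 0 = 0 := by linear_combination c - d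
    exact (mul_eq_zero.mp this).resolve_left hne
  exact ⟨y0, by rw [y0] at c; simpa using c⟩

lemma RT_or (A₁ A₂ : SL2C) (hper : ElemPeriodic A₁ A₂) (α : MulAut (FreeGroup (Fin 2))) :
    RT (tc (rho A₁ A₂ (α (FreeGroup.of 0)))) ∨
      (tc (rho A₁ A₂ (α (FreeGroup.of 1))) = 0 ∧
        tc (rho A₁ A₂ (α (FreeGroup.of 0 * FreeGroup.of 1))) = 0) := by
  set A := rho A₁ A₂ (α (FreeGroup.of 0)) with hA
  set B := rho A₁ A₂ (α (FreeGroup.of 1)) with hB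
  have h := root_of_finite (tc A) (fun k => tc (A ^ k * B)) (fun k => by
      have := tc_rec A (A ^ k * B)
      simpa [pow_succ', mul_assoc] using this) ?_
  · simpa using h
  obtain ⟨F, hF⟩ := fricke_chi (α (FreeGroup.of 1))
  obtain ⟨G, hG⟩ := fricke_chi (α (FreeGroup.of 0 * FreeGroup.of 1))
  refine ((hper (α * tw * α⁻¹)).image (fun c => (F c, G c))).subset ?_
  rintro _ ⟨k, rfl⟩
  refine ⟨_, ⟨k, rfl⟩, ?_⟩
  have e : ∀ w, ((α * tw * α⁻¹) ^ k) (α w) = α ((tw ^ k) w) := by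
    intro w
    rw [conj_pow]
    simp [MulAut.mul_apply]
  simp only [← hF, ← hG, e, map_mul, tw_pow0, tw_pow1, map_pow, ← hA, ← hB]
  rw [pow_succ', mul_assoc]

/-- The map to the infinite dihedral group. -/
def toD : FreeGroup (Fin 2) →* DihedralGroup 0 :=
  FreeGroup.lift ![DihedralGroup.r 1, DihedralGroup.sr 0]

lemma toD_surj_r : toD (FreeGroup.of 0) = DihedralGroup.r 1 := by simp [toD]
lemma toD_surj_s : toD (FreeGroup.of 1) = DihedralGroup.sr 0 := by simp [toD]

lemma toD_unit (γ : MulAut (FreeGroup (Fin 2))) (k : ZMod 0)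
    (h : toD (γ (FreeGroup.of 0)) = DihedralGroup.r k) : k = 1 ∨ k = -1 := by
  have hlift : ∀ u, toD (γ u) ∈ Subgroup.closure
      {toD (γ (FreeGroup.of 0)), toD (γ (FreeGroup.of 1))} := by
    intro u
    induction u using FreeGroup.induction_on with
    | C1 => simp
    | of i =>
      apply Subgroup.subset_closure
      fin_cases i <;> simp
    | inv_of i hi => rw [map_inv, map_inv]; exact inv_mem hi
    | mul x y hx hy => rw [map_mul, map_mul]; exact mul_mem hx hy
  have h1 := hlift (γ⁻¹ (FreeGroup.of 0))
  have h2 := hlift (γ⁻¹ (FreeGroup.of 1))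
  simp only [MulAut.apply_inv_self, toD_surj_r, toD_surj_s, h] at h1 h2
  rcases hl : toD (γ (FreeGroup.of 1)) with l | l
  · exfalso
    rw [hl] at h2
    have : ∀ x ∈ Subgroup.closure {DihedralGroup.r k, DihedralGroup.r l},
        ∃ i, x = DihedralGroup.r i := by
      intro x hx
      induction hx using Subgroup.closure_induction with
      | mem x hx => rcases hx with rfl | rfl <;> exact ⟨_, rfl⟩
      | one => exact ⟨0, rfl⟩
      | mul x y _ _ hx hy =>
        obtain ⟨i, rfl⟩ := hx
        obtain ⟨j, rfl⟩ := hy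
        exact ⟨i + j, by simp⟩
      | inv x _ hx =>
        obtain ⟨i, rfl⟩ := hx
        exact ⟨-i, by simp⟩
    obtain ⟨i, hi⟩ := this _ h2
    cases hi
  · rw [hl] at h1
    have : ∀ x ∈ Subgroup.closure {DihedralGroup.r k, DihedralGroup.sr l},
        ∃ i, x = DihedralGroup.r (k * i) ∨ x = DihedralGroup.sr (l + k * i) := by
      intro x hx
      induction hx using Subgroup.closure_induction with
      | mem x hx =>
        rcases hx with rfl | rfl
        · exact ⟨1, Or.inl (by simp)⟩
        · exact ⟨0, Or.inr (by simp)⟩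
      | one => exact ⟨0, Or.inl (by simp)⟩
      | mul x y _ _ hx hy =>
        obtain ⟨i, rfl | rfl⟩ := hx <;> obtain ⟨j, rfl | rfl⟩ := hy
        · exact ⟨i + j, Or.inl (by simp [mul_add])⟩
        · exact ⟨j - i, Or.inr (by rw [DihedralGroup.r_mul_sr]; congr 1; ring)⟩
        · exact ⟨i + j, Or.inr (by rw [DihedralGroup.sr_mul_r]; congr 1; ring)⟩
        · exact ⟨j - i, Or.inl (by rw [DihedralGroup.sr_mul_sr]; congr 1; ring)⟩
      | inv x _ hx =>
        obtain ⟨i, rfl | rfl⟩ := hx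
        · exact ⟨-i, Or.inl (by simp)⟩
        · exact ⟨i, Or.inr (by simp)⟩
    obtain ⟨i, hi | hi⟩ := this _ h1
    · have hi' : (1 : ZMod 0) = k * i := by injection hi
      have : IsUnit (k : ℤ) := IsUnit.of_mul_eq_one (M := ℤ) i hi'.symm
      exact Int.isUnit_iff.mp this
    · cases hi

/-- integer powers -/
def zp (A : SL2C) (k : ℤ) : SL2C := A ^ k

/-- A set-theoretic section of the dihedral quotient. -/
def gD (A B : SL2C) : DihedralGroup 0 → SL2C
  | DihedralGroup.r k => zp A k
  | DihedralGroup.sr k => B * zp A k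

lemma sq_neg_one (B : SL2C) (h : tc B = 0) : B * B = -1 := by
  have hB := det_eq B
  rw [tc_eq] at h
  apply Subtype.ext
  ext i j
  fin_cases i <;> fin_cases j <;>
    simp [Matrix.mul_apply, Fin.sum_univ_two] <;> grind

lemma gD_spec (A B : SL2C) (hB : tc B = 0) (hAB : tc (A * B) = 0) (w : FreeGroup (Fin 2)) :
    rho A B w = gD A B (toD w) ∨ rho A B w = -gD A B (toD w) := by
  have b2 := sq_neg_one B hB
  have ab2 := sq_neg_one _ hAB
  have hBA : A * B = B * A⁻¹ := by
    have : A * B * A * B = B * B := by rw [b2, ← ab2]; group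
    have : A * B * A = B := mul_right_cancel this
    exact eq_mul_inv_of_mul_eq this
  have hk : ∀ k : ℤ, A ^ k * B = B * A ^ (-k) := by
    intro k
    have h : SemiconjBy B A⁻¹ A := hBA.symm
    have := h.zpow_right k
    rw [_root_.zpow_neg, ← _root_.inv_zpow]
    exact this.eq.symm
  have hmul : ∀ x y : DihedralGroup 0, gD A B x * gD A B y = gD A B (x * y) ∨
      gD A B x * gD A B y = -gD A B (x * y) := by
    rintro (i | i) (j | j)
    · left
      have : ∀ i j : ℤ, A ^ i * A ^ j = A ^ (i + j) := fun i j => (_root_.zpow_add A i j).symm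
      exact this i j
    · left
      have : ∀ i j : ℤ, A ^ i * (B * A ^ j) = B * A ^ (j - i) := by
        intro i j
        rw [← mul_assoc, hk, mul_assoc, ← _root_.zpow_add, neg_add_eq_sub]
      exact this i j
    · left
      have : ∀ i j : ℤ, (B * A ^ i) * A ^ j = B * A ^ (i + j) := by
        intro i j
        rw [mul_assoc, ← _root_.zpow_add]
      exact this i j
    · right
      have : ∀ i j : ℤ, (B * A ^ i) * (B * A ^ j) = -A ^ (j - i) := by
        intro i j
        have : (B * A ^ i) * (B * A ^ j) = B * (A ^ i * B) * A ^ j := by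
          simp only [mul_assoc]
        rw [this, hk, ← mul_assoc, b2, mul_assoc, ← _root_.zpow_add, neg_one_mul, neg_add_eq_sub]
      exact this i j
  have hone : gD A B 1 = 1 := by
    exact zpow_zero A
  induction w using FreeGroup.induction_on with
  | C1 => left; rw [map_one, map_one, hone]
  | of i =>
    left
    fin_cases i
    · change rho A B (FreeGroup.of 0) = gD A B (toD (FreeGroup.of 0))
      rw [rho_of0, toD_surj_r]
      exact (zpow_one A).symm
    · change rho A B (FreeGroup.of 1) = gD A B (toD (FreeGroup.of 1))
      rw [rho_of1, toD_surj_s]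
      have : B = B * A ^ (0 : ℤ) := by simp
      exact this
  | inv_of i hi =>
    rw [map_inv, map_inv]
    have := hmul (toD (FreeGroup.of i)) (toD (FreeGroup.of i))⁻¹
    rw [mul_inv_cancel, hone] at this
    rcases hi with hi | hi <;> rcases this with h | h <;> rw [hi]
    · left; exact inv_eq_of_mul_eq_one_right h
    · right; exact inv_eq_of_mul_eq_one_right (by rw [mul_neg, h, neg_neg])
    · right; exact inv_eq_of_mul_eq_one_right (by rw [neg_mul_neg, h])
    · left; exact inv_eq_of_mul_eq_one_right (by rw [neg_mul, h, neg_neg])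
  | mul x y hx hy =>
    rw [map_mul, map_mul]
    have := hmul (toD x) (toD y)
    rcases hx with hx | hx <;> rcases hy with hy | hy <;> rcases this with h | h <;>
      rw [hx, hy] <;> simp [h]

lemma tc_neg (A : SL2C) : tc (-A) = - tc A := by simp [tc]

lemma tc_inv (A : SL2C) : tc A⁻¹ = tc A := by
  rw [tc, inv_eq']; simp [tc, Matrix.trace_sub, Matrix.trace_smul]; ring

lemma dihedral_trace (A B : SL2C) (hB : tc B = 0) (hAB : tc (A * B) = 0)
    (γ : MulAut (FreeGroup (Fin 2))) :
    tc (rho A B (γ (FreeGroup.of 0))) ∈ ({tc A, -tc A, 0} : Set ℂ) := by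
  have main : tc (gD A B (toD (γ (FreeGroup.of 0)))) = tc A ∨
      tc (gD A B (toD (γ (FreeGroup.of 0)))) = 0 := by
    rcases hk : toD (γ (FreeGroup.of 0)) with k | k
    · left
      rcases toD_unit γ k hk with rfl | rfl
      · exact congrArg tc (zpow_one A)
      · exact (congrArg tc (_root_.zpow_neg_one A)).trans (tc_inv A)
    · right
      have key : ∀ k : ℕ, tc (A ^ k * B) = 0 ∧ tc (A ^ (k + 1) * B) = 0 := by
        intro k
        induction k with
        | zero => simpa using ⟨hB, hAB⟩
        | succ k ih =>
          refine ⟨ih.2, ?_⟩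
          have := tc_rec A (A ^ k * B)
          rw [← mul_assoc A (A ^ k), ← pow_succ', ← mul_assoc, ← pow_succ', ih.1, ih.2] at this
          simpa using this
      have hBi : tc (A⁻¹ * B) = 0 := by
        have := tc_rec A (A⁻¹ * B)
        rw [mul_inv_cancel_left, hAB, hB] at this
        simpa using this.symm
      have key' : ∀ k : ℕ, tc (A⁻¹ ^ k * B) = 0 ∧ tc (A⁻¹ ^ (k + 1) * B) = 0 := by
        intro k
        induction k with
        | zero => simpa using ⟨hB, hBi⟩
        | succ k ih =>
          refine ⟨ih.2, ?_⟩
          have := tc_rec A⁻¹ (A⁻¹ ^ k * B)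
          rw [← mul_assoc A⁻¹ (A⁻¹ ^ k), ← pow_succ', ← mul_assoc, ← pow_succ', ih.1, ih.2] at this
          simpa using this
      have : ∀ k : ℤ, tc (B * A ^ k) = 0 := by
        intro k
        rw [tc_mul_comm]
        obtain ⟨n, hn | hn⟩ := Int.eq_nat_or_neg k
        · rw [hn, zpow_natCast]; exact (key n).1
        · rw [hn, _root_.zpow_neg, zpow_natCast, ← inv_pow]; exact (key' n).1
      exact this k
  rcases gD_spec A B hB hAB (γ (FreeGroup.of 0)) with h | h <;> rw [h] <;>
    rcases main with h' | h' <;> simp [tc_neg, h']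

/-- It suffices to bound the traces of the images of the first generator. -/
lemma finite_of_first (A B : SL2C)
    (h : (Set.range fun γ : MulAut (FreeGroup (Fin 2)) =>
      tc (rho A B (γ (FreeGroup.of 0)))).Finite) :
    (Set.range fun α : MulAut (FreeGroup (Fin 2)) => chi A B α).Finite := by
  refine ((h.prod (h.prod h)).image (fun c : ℂ × ℂ × ℂ => (c.1 / 2, c.2.1 / 2, c.2.2 / 2))).subset ?_
  rintro _ ⟨α, rfl⟩
  refine ⟨(tc (rho A B (α (FreeGroup.of 0))), tc (rho A B (α (FreeGroup.of 1))),
      tc (rho A B (α (FreeGroup.of 0 * FreeGroup.of 1)))), ⟨⟨α, rfl⟩, ⟨α * sw, ?_⟩,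
      ⟨α * (tw * sw), ?_⟩⟩, rfl⟩
  · simp only [MulAut.mul_apply, sw0]
  · simp only [MulAut.mul_apply, sw0, tw1]

lemma RT_isIntegral {t : ℂ} (h : RT t) : IsIntegral ℤ t := by
  obtain ⟨l, m, hlm, rfl, n, hn, hl⟩ := h
  have hm : m ^ n = 1 := by
    have := congrArg (· ^ n) hlm; simpa [mul_pow, hl] using this
  have : ∀ x : ℂ, x ^ n = 1 → IsIntegral ℤ x := fun x hx =>
    IsIntegral.of_pow hn (by rw [hx]; exact isIntegral_one)
  exact (this l hl).add (this m hm)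

lemma RT_dickson {t : ℂ} (h : RT t) :
    ∃ n : ℕ, 0 < n ∧ (Polynomial.dickson 1 (1 : ℂ) n).eval t = 2 := by
  obtain ⟨l, m, hlm, rfl, n, hn, hl⟩ := h
  have hm : m ^ n = 1 := by
    have := congrArg (· ^ n) hlm; simpa [mul_pow, hl] using this
  refine ⟨n, hn, ?_⟩
  rw [Polynomial.dickson_one_one_eval_add_inv l m hlm, hl, hm]
  norm_num

lemma norm_le_of_dickson {t : ℂ} {n : ℕ} (hn : 0 < n)
    (h : (Polynomial.dickson 1 (1 : ℂ) n).eval t = 2) : ‖t‖ ≤ 2 := by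
  obtain ⟨l, m, hlm, rfl⟩ := exists_pair t
  rw [Polynomial.dickson_one_one_eval_add_inv l m hlm] at h
  have hp : l ^ n * m ^ n = 1 := by rw [← mul_pow, hlm, one_pow]
  have h1 : (l ^ n - 1) ^ 2 = 0 := by linear_combination l ^ n * h - hp
  have hl : l ^ n = 1 := sub_eq_zero.mp (pow_eq_zero_iff (by norm_num) |>.mp h1)
  have hm : m ^ n = 1 := by rw [hl, one_mul] at hp; exact hp
  have := norm_add_le l m
  rw [Complex.norm_eq_one_of_pow_eq_one hl hn.ne', Complex.norm_eq_one_of_pow_eq_one hm hn.ne'] at this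
  linarith

lemma finite_RT (s : Set ℂ) (hs : s.Finite) (hi : ∀ x ∈ s, IsIntegral ℚ x) :
    {t : ℂ | t ∈ IntermediateField.adjoin ℚ s ∧ RT t}.Finite := by
  have : Finite s := hs
  have hfd : FiniteDimensional ℚ (IntermediateField.adjoin ℚ s) :=
    IntermediateField.finiteDimensional_adjoin hi
  have : NumberField (IntermediateField.adjoin ℚ s) := ⟨⟩
  refine ((NumberField.Embeddings.finite_of_norm_le (IntermediateField.adjoin ℚ s) ℂ 2).image
    (fun x : IntermediateField.adjoin ℚ s => (x : ℂ))).subset ?_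
  rintro t ⟨ht, hR⟩
  refine ⟨⟨t, ht⟩, ⟨?_, fun φ => ?_⟩, rfl⟩
  · have := RT_isIntegral hR
    exact (isIntegral_algHom_iff
      ((IntermediateField.adjoin ℚ s).val.restrictScalars ℤ) Subtype.val_injective).mp this
  · obtain ⟨n, hn, h⟩ := RT_dickson hR
    apply norm_le_of_dickson hn
    have h0 : (Polynomial.dickson 1 (1 : IntermediateField.adjoin ℚ s) n).eval ⟨t, ht⟩ = 2 := by
      apply (algebraMap (IntermediateField.adjoin ℚ s) ℂ).injective
      rw [← Polynomial.eval_map_apply, Polynomial.map_dickson, map_one, map_ofNat]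
      exact h
    have := congrArg φ h0
    rwa [← Polynomial.eval_map_apply, Polynomial.map_dickson, map_one, map_ofNat] at this

theorem stmt1 (A₁ A₂ : SL2C)
    (htr1 : (Matrix.trace ((A₁ : Matrix (Fin 2) (Fin 2) ℂ))).im = 0)
    (htr2 : (Matrix.trace ((A₂ : Matrix (Fin 2) (Fin 2) ℂ))).im = 0)
    (htr12 : (Matrix.trace (((A₁ * A₂ : SL2C) : Matrix (Fin 2) (Fin 2) ℂ))).im = 0)
    (hper : ElemPeriodic A₁ A₂) :
    (Set.range fun α : MulAut (FreeGroup (Fin 2)) => chi A₁ A₂ α).Finite := by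
  by_cases hdeg : ∃ α : MulAut (FreeGroup (Fin 2)), tc (rho A₁ A₂ (α (FreeGroup.of 1))) = 0 ∧
        tc (rho A₁ A₂ (α (FreeGroup.of 0 * FreeGroup.of 1))) = 0
  · obtain ⟨α, h1, h2⟩ := hdeg
    rw [map_mul, map_mul] at h2
    apply finite_of_first
    refine Set.Finite.subset (Set.toFinite ({tc (rho A₁ A₂ (α (FreeGroup.of 0))),
      -tc (rho A₁ A₂ (α (FreeGroup.of 0))), 0} : Set ℂ)) ?_
    rintro _ ⟨β, rfl⟩
    have := dihedral_trace _ _ h1 h2 (α⁻¹ * β)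
    rw [← rho_comp, MulAut.mul_apply, MulAut.apply_inv_self] at this
    exact this
  · have hRT : ∀ α : MulAut (FreeGroup (Fin 2)), RT (tc (rho A₁ A₂ (α (FreeGroup.of 0)))) :=
      fun α => (RT_or A₁ A₂ hper α).resolve_right fun h => hdeg ⟨α, h⟩
    have hX : RT (tc A₁) := by simpa [rho_of0] using hRT 1
    have hY : RT (tc A₂) := by simpa [sw0, rho_of1] using hRT sw
    have hZ : RT (tc (A₁ * A₂)) := by
      simpa [MulAut.mul_apply, sw0, tw1, rho_of0, rho_of1] using hRT (tw * sw)
    apply finite_of_first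
    refine (finite_RT (Set.range (tv A₁ A₂)) (Set.finite_range _) ?_).subset ?_
    · rintro _ ⟨i, rfl⟩
      fin_cases i
      · exact (RT_isIntegral hX).tower_top
      · exact (RT_isIntegral hY).tower_top
      · exact (RT_isIntegral hZ).tower_top
    · rintro _ ⟨α, rfl⟩
      refine ⟨?_, hRT α⟩
      obtain ⟨T, hT⟩ := fricke (α (FreeGroup.of 0))
      change tc (rho A₁ A₂ (α (FreeGroup.of 0))) ∈ _
      rw [hT]
      have hmem : ∀ i, tv A₁ A₂ i ∈ IntermediateField.adjoin ℚ (Set.range (tv A₁ A₂)) :=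
        fun i => IntermediateField.subset_adjoin _ _ ⟨i, rfl⟩
      clear hT
      induction T using MvPolynomial.induction_on with
      | C a => simp
      | add p q hp hq => rw [map_add]; exact add_mem hp hq
      | mul_X p i hp => rw [map_mul, MvPolynomial.aeval_X]; exact mul_mem hp (hmem i)
end
end

section
/- Let p ∈ ℝ³ satisfy E(p) = 1. Then p has finite orbit under the cyclic group ⟨γ⟩ for every element γ ∈ Γ₂ if and only if there exist rational numbers θ₁, θ₂ with p = Π₂(θ₁,θ₂). -/
open Real

noncomputable section

/-- `σ₁(x,y,z) = (z, y, 2yz − x)` as a bijection of `ℝ³`. -/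
def sigma1 : Equiv.Perm (ℝ × ℝ × ℝ) where
  toFun p := (p.2.2, p.2.1, 2 * p.2.1 * p.2.2 - p.1)
  invFun p := (2 * p.2.1 * p.1 - p.2.2, p.2.1, p.1)
  left_inv := by rintro ⟨x, y, z⟩; simp [Prod.ext_iff]
  right_inv := by rintro ⟨x, y, z⟩; simp [Prod.ext_iff]

/-- `σ₂(x,y,z) = (x, 2xy − z, y)` as a bijection of `ℝ³`. -/
def sigma2 : Equiv.Perm (ℝ × ℝ × ℝ) where
  toFun p := (p.1, 2 * p.1 * p.2.1 - p.2.2, p.2.1)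
  invFun p := (p.1, p.2.2, 2 * p.1 * p.2.2 - p.2.1)
  left_inv := by rintro ⟨x, y, z⟩; simp [Prod.ext_iff]
  right_inv := by rintro ⟨x, y, z⟩; simp [Prod.ext_iff]

/-- `Γ₂` is the group of bijections of `ℝ³` generated by `σ₁` and `σ₂`. -/
def Gamma2 : Subgroup (Equiv.Perm (ℝ × ℝ × ℝ)) := Subgroup.closure {sigma1, sigma2}

/-- `Π₂(θ₁,θ₂) = (cos 2πθ₁, cos 2πθ₂, cos 2π(θ₁+θ₂))`. -/
def Pi2 (θ₁ θ₂ : ℝ) : ℝ × ℝ × ℝ :=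
  (Real.cos (2 * π * θ₁), Real.cos (2 * π * θ₂), Real.cos (2 * π * (θ₁ + θ₂)))

/-- `E(x,y,z) = x² + y² + z² − 2xyz`. -/
def E (p : ℝ × ℝ × ℝ) : ℝ :=
  p.1 ^ 2 + p.2.1 ^ 2 + p.2.2 ^ 2 - 2 * p.1 * p.2.1 * p.2.2

theorem aux_period (f : Equiv.Perm (ℝ × ℝ × ℝ)) (p : ℝ × ℝ × ℝ)
    (h : (Set.range fun k : ℤ => (f ^ k) p).Finite) : ∃ m : ℤ, m ≠ 0 ∧ (f ^ m) p = p := by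
  by_contra hc
  push Not at hc
  refine Set.infinite_range_of_injective (f := fun k : ℤ => (f ^ k) p) ?_ h
  intro k l hkl
  by_contra hne
  refine hc (k - l) (sub_ne_zero.2 hne) ?_
  have : (f ^ k) p = (f ^ l) p := hkl
  rw [sub_eq_neg_add, zpow_add, Equiv.Perm.mul_apply, this, ← Equiv.Perm.mul_apply, ← zpow_add]
  simp

theorem aux_max (f : Equiv.Perm (ℝ × ℝ × ℝ)) (p : ℝ × ℝ × ℝ)
    (h : (Set.range fun k : ℤ => (f ^ k) p).Finite) (P : ℝ × ℝ × ℝ → Prop) (hp : P p)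
    (h1 : ∀ q, P q → P (f q)) (h2 : ∀ q, P q → P (f⁻¹ q)) (φ : ℝ × ℝ × ℝ → ℝ) :
    ∃ q, P q ∧ φ (f q) ≤ φ q ∧ φ (f⁻¹ q) ≤ φ q := by
  obtain ⟨q, ⟨k, rfl⟩, hq⟩ := Set.exists_max_image _ φ h ⟨_, 0, rfl⟩
  have hall : ∀ k : ℤ, P ((f ^ k) p) := by
    intro k
    induction k using Int.induction_on with
    | zero => simpa using hp
    | succ n ih =>
      rw [add_comm, zpow_add, zpow_one, Equiv.Perm.mul_apply]; exact h1 _ ih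
    | pred n ih =>
      rw [sub_eq_neg_add, zpow_add, zpow_neg_one, Equiv.Perm.mul_apply]; exact h2 _ ih
  refine ⟨_, hall k, hq _ ⟨1 + k, ?_⟩, hq _ ⟨-1 + k, ?_⟩⟩
  · simp only [zpow_add, zpow_one, Equiv.Perm.mul_apply]
  · simp only [zpow_add, zpow_neg_one, Equiv.Perm.mul_apply]

theorem s1_apply (x y z : ℝ) : sigma1 (x, y, z) = (z, y, 2 * y * z - x) := rfl
theorem s1_inv (x y z : ℝ) : sigma1⁻¹ (x, y, z) = (2 * y * x - z, y, x) := rfl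
theorem s2_apply (x y z : ℝ) : sigma2 (x, y, z) = (x, 2 * x * y - z, y) := rfl
theorem s2_inv (x y z : ℝ) : sigma2⁻¹ (x, y, z) = (x, z, 2 * x * z - y) := rfl

theorem aux_hyp (x y z : ℝ) (hy : 1 < |y|) (h1 : |2 * y * z - x| ≤ |z|) (h2 : |x| ≤ |z|) :
    x = 0 ∧ z = 0 := by
  have h3 : |2 * y * z| ≤ |2 * y * z - x| + |x| := by
    simpa using abs_add_le (2 * y * z - x) x
  rw [abs_mul, abs_mul, abs_two] at h3
  have hz : |z| = 0 := by nlinarith [abs_nonneg z]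
  exact ⟨abs_eq_zero.1 (le_antisymm (h2.trans hz.le) (abs_nonneg _)), abs_eq_zero.1 hz⟩

theorem aux_y (x y z : ℝ) (hE : E (x, y, z) = 1)
    (h : (Set.range fun k : ℤ => (sigma1 ^ k) (x, y, z)).Finite) : |y| ≤ 1 := by
  by_contra! hy
  obtain ⟨⟨a, b, c⟩, ⟨hq1, hq2⟩, h1, h2⟩ := aux_max sigma1 _ h (fun q => E q = 1 ∧ q.2.1 = y)
    ⟨hE, rfl⟩
    (by rintro ⟨a, b, c⟩ ⟨h, h'⟩; rw [s1_apply]; refine ⟨?_, h'⟩; rw [← h]; simp only [E]; ring)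
    (by rintro ⟨a, b, c⟩ ⟨h, h'⟩; rw [s1_inv]; refine ⟨?_, h'⟩; rw [← h]; simp only [E]; ring)
    (fun q => |q.2.2|)
  simp only [s1_apply, s1_inv] at h1 h2 hq2
  subst hq2
  obtain ⟨rfl, rfl⟩ := aux_hyp a b c hy h1 h2
  simp [E] at hq1
  rcases hq1 with h | h <;> simp [h] at hy

theorem aux_x (x y z : ℝ) (hE : E (x, y, z) = 1)
    (h : (Set.range fun k : ℤ => (sigma2 ^ k) (x, y, z)).Finite) : |x| ≤ 1 := by
  by_contra! hy
  obtain ⟨⟨a, b, c⟩, ⟨hq1, hq2⟩, h1, h2⟩ := aux_max sigma2 _ h (fun q => E q = 1 ∧ q.1 = x)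
    ⟨hE, rfl⟩
    (by rintro ⟨a, b, c⟩ ⟨h, h'⟩; rw [s2_apply]; refine ⟨?_, h'⟩; rw [← h]; simp only [E]; ring)
    (by rintro ⟨a, b, c⟩ ⟨h, h'⟩; rw [s2_inv]; refine ⟨?_, h'⟩; rw [← h]; simp only [E]; ring)
    (fun q => |q.2.1|)
  simp only [s2_apply, s2_inv] at h1 h2 hq2
  subst hq2
  obtain ⟨rfl, rfl⟩ := aux_hyp c a b hy h1 h2
  simp [E] at hq1
  rcases hq1 with h | h <;> simp [h] at hy

theorem two_cos (a b : ℝ) : 2 * cos a * cos b = cos (a + b) + cos (a - b) := by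
  rw [cos_add, cos_sub]; ring

theorem s1_Pi (a b : ℝ) : sigma1 (Pi2 a b) = Pi2 (a + b) b := by
  simp only [Pi2, s1_apply, two_cos, Prod.mk.injEq, true_and]
  rw [show 2 * π * b - 2 * π * (a + b) = - (2 * π * a) by ring, cos_neg, add_sub_cancel_right]
  ring_nf

theorem s1_Pi_inv (a b : ℝ) : sigma1⁻¹ (Pi2 a b) = Pi2 (a - b) b := by
  rw [Equiv.Perm.inv_eq_iff_eq, s1_Pi, sub_add_cancel]

theorem s2_Pi (a b : ℝ) : sigma2 (Pi2 a b) = Pi2 a (b - a) := by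
  simp only [Pi2, s2_apply, two_cos, Prod.mk.injEq, true_and]
  rw [← mul_add, add_sub_cancel_left, ← mul_sub, ← neg_sub b a, mul_neg, cos_neg, 
    add_sub_cancel]
  simp

theorem s2_Pi_inv (a b : ℝ) : sigma2⁻¹ (Pi2 a b) = Pi2 a (b + a) := by
  rw [Equiv.Perm.inv_eq_iff_eq, s2_Pi, add_sub_cancel_right]

theorem s1_zpow (a b : ℝ) (k : ℤ) : (sigma1 ^ k) (Pi2 a b) = Pi2 (a + k * b) b := by
  induction k using Int.induction_on with
  | zero => simp
  | succ n ih =>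
    rw [add_comm, zpow_add, zpow_one, Equiv.Perm.mul_apply, ih, s1_Pi]; push_cast; ring_nf
  | pred n ih =>
    rw [sub_eq_neg_add, zpow_add, zpow_neg_one, Equiv.Perm.mul_apply, ih, s1_Pi_inv]
    push_cast; ring_nf

theorem s2_zpow (a b : ℝ) (k : ℤ) : (sigma2 ^ k) (Pi2 a b) = Pi2 a (b - k * a) := by
  induction k using Int.induction_on with
  | zero => simp
  | succ n ih =>
    rw [add_comm, zpow_add, zpow_one, Equiv.Perm.mul_apply, ih, s2_Pi]; push_cast; ring_nf
  | pred n ih =>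
    rw [sub_eq_neg_add, zpow_add, zpow_neg_one, Equiv.Perm.mul_apply, ih, s2_Pi_inv]
    push_cast; ring_nf

theorem cos_eq (a b : ℝ) (h : cos (2 * π * a) = cos (2 * π * b)) :
    ∃ n : ℤ, b = n + a ∨ b = n - a := by
  obtain ⟨k, hk⟩ := Real.cos_eq_cos_iff.1 h
  have hpi : (2 * π) ≠ 0 := by positivity
  refine ⟨k, hk.imp (fun h => ?_) (fun h => ?_)⟩ <;> apply mul_left_cancel₀ hpi <;> linarith

/-- If translation by a nonzero multiple of `b` fixes the two cosines, then `b` is rational. -/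
theorem aux_rat (a b : ℝ) (m : ℤ) (hm : m ≠ 0)
    (h1 : cos (2 * π * a) = cos (2 * π * (a + m * b)))
    (h2 : cos (2 * π * (a + b)) = cos (2 * π * (a + b + m * b))) : ∃ r : ℚ, b = r := by
  have hm' : (m : ℝ) ≠ 0 := by exact_mod_cast hm
  obtain ⟨n, hn | hn⟩ := cos_eq _ _ h1
  · refine ⟨n / m, ?_⟩
    push_cast
    rw [eq_div_iff hm']; linarith
  · obtain ⟨l, hl | hl⟩ := cos_eq _ _ h2
    · refine ⟨l / m, ?_⟩
      push_cast
      rw [eq_div_iff hm']; linarith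
    · refine ⟨(l - n) / 2, ?_⟩
      push_cast
      linarith

theorem aux_param (x y z : ℝ) (hE : E (x, y, z) = 1) (hx : |x| ≤ 1) (hy : |y| ≤ 1) :
    ∃ a b : ℝ, (x, y, z) = Pi2 a b := by
  have hpi : (2 * π) ≠ 0 := by positivity
  rw [abs_le] at hx hy
  have key : ∀ a b : ℝ, x = cos a → y = cos b → z = cos (a + b) →
      ∃ a b : ℝ, (x, y, z) = Pi2 a b := by
    intro a b h1 h2 h3
    refine ⟨a / (2 * π), b / (2 * π), ?_⟩
    simp only [Pi2, ← add_div, mul_div_cancel₀ _ hpi, h1, h2, h3]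
  have e1 := Real.cos_arccos hx.1 hx.2
  have e2 := Real.cos_arccos hy.1 hy.2
  have s1 := Real.sin_sq (arccos x)
  have s2 := Real.sin_sq (arccos y)
  have : (z - cos (arccos x + arccos y)) * (z - cos (arccos x + -arccos y)) = 0 := by
    rw [cos_add, cos_add, cos_neg, sin_neg, e1, e2]
    rw [e1] at s1
    rw [e2] at s2
    simp only [E] at hE
    have : sin (arccos x) ^ 2 * sin (arccos y) ^ 2 = (1 - x ^ 2) * (1 - y ^ 2) := by rw [s1, s2]
    linear_combination hE - this
  rcases mul_eq_zero.1 this with h | h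
  · exact key _ _ e1.symm e2.symm (sub_eq_zero.1 h)
  · exact key _ (-arccos y) e1.symm (by rw [cos_neg, e2]) (sub_eq_zero.1 h)

/-- The torsion points of level `N`. -/
def tors (N : ℕ) : Set (ℝ × ℝ × ℝ) := Set.range fun v : ℤ × ℤ => Pi2 (v.1 / N) (v.2 / N)

theorem cos_mod (N : ℕ) (hN : 0 < N) (i : ℤ) :
    cos (2 * π * (i / N)) = cos (2 * π * ((i % N : ℤ) / N)) := by
  have hN' : (N : ℝ) ≠ 0 := by positivity
  have : (i : ℝ) = ((i % N : ℤ) : ℝ) + N * ((i / N : ℤ) : ℝ) := by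
    exact_mod_cast (Int.emod_add_mul_ediv i N).symm
  rw [Real.cos_eq_cos_iff]
  refine ⟨-(i / N), Or.inl ?_⟩
  push_cast
  rw [this]
  field_simp
  push_cast
  ring

theorem tors_finite (N : ℕ) (hN : 0 < N) : (tors N).Finite := by
  have hfin : (Set.range fun i : ℤ => cos (2 * π * (i / N))).Finite := by
    refine ((Set.finite_Icc (0 : ℤ) N).image fun i : ℤ => cos (2 * π * (i / N))).subset ?_
    rintro _ ⟨i, rfl⟩
    have h0 : (0 : ℤ) < N := by exact_mod_cast hN
    exact ⟨i % N, ⟨Int.emod_nonneg _ h0.ne', (Int.emod_lt_of_pos _ h0).le⟩, (cos_mod N hN i).symm⟩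
  refine (hfin.prod (hfin.prod hfin)).subset ?_
  rintro _ ⟨⟨i, j⟩, rfl⟩
  refine ⟨⟨i, rfl⟩, ⟨j, rfl⟩, ⟨i + j, ?_⟩⟩
  simp only [Pi2, ← add_div]
  push_cast
  rfl

theorem tors_inv (N : ℕ) (γ : Equiv.Perm (ℝ × ℝ × ℝ)) (hγ : γ ∈ Gamma2) :
    ∀ q ∈ tors N, γ q ∈ tors N ∧ γ⁻¹ q ∈ tors N := by
  induction hγ using Subgroup.closure_induction with
  | mem g hg =>
    rintro _ ⟨⟨i, j⟩, rfl⟩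
    rcases hg with rfl | rfl
    · simp only [s1_Pi, s1_Pi_inv]
      exact ⟨⟨(i + j, j), by push_cast; ring_nf⟩, ⟨(i - j, j), by push_cast; ring_nf⟩⟩
    · simp only [s2_Pi, s2_Pi_inv]
      exact ⟨⟨(i, j - i), by push_cast; ring_nf⟩, ⟨(i, j + i), by push_cast; ring_nf⟩⟩
  | one => intro q hq; simpa using hq
  | mul g h _ _ hg hh =>
    intro q hq
    rw [mul_inv_rev]
    exact ⟨(hg _ (hh q hq).1).1, (hh _ (hg q hq).2).2⟩
  | inv g _ hg =>
    intro q hq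
    rw [inv_inv]
    exact (hg q hq).symm

theorem stmt3 (p : ℝ × ℝ × ℝ) (hE : E p = 1) :
    (∀ γ ∈ Gamma2, (Set.range fun k : ℤ => (γ ^ k) p).Finite) ↔
      (∃ θ₁ θ₂ : ℚ, p = Pi2 θ₁ θ₂) := by
  constructor
  · intro h
    have hs1 := h sigma1 (Subgroup.subset_closure (by simp))
    have hs2 := h sigma2 (Subgroup.subset_closure (by simp))
    obtain ⟨x, y, z⟩ := p
    obtain ⟨a, b, hab⟩ := aux_param x y z hE (aux_x x y z hE hs2) (aux_y x y z hE hs1)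
    rw [hab] at hs1 hs2 ⊢
    obtain ⟨m, hm, hm1⟩ := aux_period _ _ hs1
    obtain ⟨n, hn, hn1⟩ := aux_period _ _ hs2
    rw [s1_zpow] at hm1
    rw [s2_zpow] at hn1
    simp only [Pi2, Prod.mk.injEq] at hm1 hn1
    obtain ⟨r, rfl⟩ := aux_rat a b m hm hm1.1.symm (by rw [← hm1.2.2]; ring_nf)
    obtain ⟨s, rfl⟩ := aux_rat r a (-n) (neg_ne_zero.2 hn)
      (by rw [← hn1.2.1]; push_cast; ring_nf)
      (by rw [add_comm, ← hn1.2.2]; push_cast; ring_nf)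
    exact ⟨s, r, rfl⟩
  · rintro ⟨a, b, rfl⟩ γ hγ
    have hN : 0 < a.den * b.den := Nat.mul_pos a.den_pos b.den_pos
    refine (tors_finite _ hN).subset ?_
    rintro _ ⟨k, rfl⟩
    refine (tors_inv _ _ (Subgroup.zpow_mem _ hγ k) _ ⟨(a.num * b.den, b.num * a.den), ?_⟩).1
    have ha : (a.den : ℝ) ≠ 0 := by exact_mod_cast a.den_pos.ne'
    have hb : (b.den : ℝ) ≠ 0 := by exact_mod_cast b.den_pos.ne'
    have ea : (a : ℝ) = a.num / a.den := Rat.cast_def a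
    have eb : (b : ℝ) = b.num / b.den := Rat.cast_def b
    simp only [ea, eb]
    push_cast
    congr 1 <;> field_simp

end
end
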